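/- For every s > 0, the area of the flower region F(0) around the origin of the triangular lattice with edge length s equals (π − 6·arcsin(1/4) − 3√3(√5 − 1)/8)·s². Equivalently, for a triangular lattice with edge length r/2 (so s = r/2), the flower area is S_f = (1/4)(π − 6φ − 3√3(√5−1)/8)·r² with φ = arcsin(1/4). -/

import Mathlib

open MeasureTheory Metric Real

/-- The point `(a, b)` of the Euclidean plane. -/
noncomputable def planePt (a b : ℝ) : EuclideanSpace ℝ (Fin 2) :=
  (WithLp.equiv 2 (Fin 2 → ℝ)).symm ![a, b]

/-- The flower region around a site `v` of the triangular lattice with edge length `s`: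
the intersection of the six closed disks of radius `s` centered at the midpoints
`v + (s/2)·(cos(kπ/3), sin(kπ/3))`, `k = 0,…,5`, of the edges incident to `v`. -/
noncomputable def flower (s : ℝ) (v : EuclideanSpace ℝ (Fin 2)) :
    Set (EuclideanSpace ℝ (Fin 2)) :=
  ⋂ k : Fin 6, closedBall
    (v + (s / 2) • planePt (Real.cos ((k : ℕ) * Real.pi / 3))
      (Real.sin ((k : ℕ) * Real.pi / 3))) s

theorem integral_sqrt_one_sub_sq_of_le {p q : ℝ} (hp : -1 ≤ p) (hpq : p ≤ q) (hq : q ≤ 1) :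
    ∫ u in p..q, √(1 - u ^ 2) =
      (q * √(1 - q ^ 2) + arcsin q) / 2 - (p * √(1 - p ^ 2) + arcsin p) / 2 := by
  refine intervalIntegral.integral_eq_sub_of_hasDerivAt_of_le
    (f := fun u => (u * √(1 - u ^ 2) + arcsin u) / 2) hpq
    (by fun_prop) (fun u hu => ?_)
    (Continuous.intervalIntegrable (by fun_prop) _ _)
  have hpos : 0 < 1 - u ^ 2 := by nlinarith [hu.1, hu.2]
  have h1 : HasDerivAt (fun u : ℝ => 1 - u ^ 2) (-(2 * u)) u := by
    simpa using (hasDerivAt_pow 2 u).const_sub 1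
  have h2 := (((hasDerivAt_id u).mul (h1.sqrt hpos.ne')).add
    (hasDerivAt_arcsin (by linarith [hu.1]) (by linarith [hu.2]))).div_const 2
  refine h2.congr_deriv ?_
  have hne : √(1 - u ^ 2) ≠ 0 := (sqrt_pos.2 hpos).ne'
  have hsq : √(1 - u ^ 2) ^ 2 = 1 - u ^ 2 := sq_sqrt hpos.le
  simp only [id]
  field_simp
  rw [hsq]
  ring

theorem arcsin_quarter_mem : arcsin (1 / 4) ∈ Set.Icc 0 (π / 6) := by
  refine ⟨arcsin_nonneg.2 (by norm_num), ?_⟩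
  have h : arcsin (1 / 2) = π / 6 :=
    arcsin_eq_of_sin_eq sin_pi_div_six ⟨by linarith [pi_pos], by linarith [pi_pos]⟩
  exact h ▸ arcsin_le_arcsin (by norm_num)

theorem sqrt_three_mul_cos_arcsin_quarter : √3 * cos (arcsin (1 / 4)) = 3 * √5 / 4 := by
  rw [cos_arcsin, ← sqrt_mul (by norm_num),
    show (3 : ℝ) * (1 - (1 / 4) ^ 2) = (3 / 4) ^ 2 * 5 by norm_num,
    sqrt_mul (by norm_num), sqrt_sq (by norm_num)]
  ring

theorem arcsin_three_mul_sqrt_five_sub_one_div_eight :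
    arcsin ((3 * √5 - 1) / 8) = π / 3 - arcsin (1 / 4) := by
  have h := arcsin_quarter_mem
  refine arcsin_eq_of_sin_eq ?_ ⟨by linarith [h.2, pi_pos], by linarith [h.1, pi_pos]⟩
  rw [sin_sub, sin_pi_div_three, cos_pi_div_three, sin_arcsin (by norm_num) (by norm_num)]
  linear_combination sqrt_three_mul_cos_arcsin_quarter / 2

theorem arcsin_three_mul_sqrt_five_add_one_div_eight :
    arcsin ((3 * √5 + 1) / 8) = π / 3 + arcsin (1 / 4) := by
  have h := arcsin_quarter_mem
  refine arcsin_eq_of_sin_eq ?_ ⟨by linarith [h.1, pi_pos], by linarith [h.2, pi_pos]⟩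
  rw [sin_add, sin_pi_div_three, cos_pi_div_three, sin_arcsin (by norm_num) (by norm_num)]
  linear_combination sqrt_three_mul_cos_arcsin_quarter / 2

/-- Half the length of the vertical chord of the unit flower at distance `t` from its axis. -/
noncomputable def halfChord (t : ℝ) : ℝ :=
  min √(1 - (t + 1 / 2) ^ 2) (√(1 - (t + 1 / 4) ^ 2) - √3 / 4)

theorem continuous_halfChord : Continuous halfChord := by
  unfold halfChord
  fun_prop

theorem sqrt_five_bounds : 2 < √5 ∧ √5 < 7 / 3 :=
  ⟨lt_sqrt_of_sq_lt (by norm_num), (sqrt_lt' (by norm_num)).2 (by norm_num)⟩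

theorem sqrt_three_div_four_le {t : ℝ} (h0 : 0 ≤ t) (ht : t ≤ 1 / 2) :
    √3 / 4 ≤ √(1 - (t + 1 / 4) ^ 2) := by
  apply le_sqrt_of_sq_le
  rw [div_pow, sq_sqrt (by norm_num)]
  nlinarith

theorem halfChord_nonneg {t : ℝ} (h0 : 0 ≤ t) (ht : t ≤ 1 / 2) : 0 ≤ halfChord t :=
  le_min (sqrt_nonneg _) (sub_nonneg.2 (sqrt_three_div_four_le h0 ht))

theorem halfChord_nonpos {t : ℝ} (ht : 1 / 2 < t) : halfChord t ≤ 0 :=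
  (min_le_left _ _).trans_eq (sqrt_eq_zero_of_nonpos (by nlinarith))

theorem halfChord_eq_of_le {t : ℝ} (h0 : 0 ≤ t) (ht : t ≤ 3 * (√5 - 1) / 8) :
    halfChord t = √(1 - (t + 1 / 4) ^ 2) - √3 / 4 := by
  obtain ⟨h1, h2⟩ := sqrt_five_bounds
  have h5 : √5 ^ 2 = 5 := sq_sqrt (by norm_num)
  have h3 : √3 ^ 2 = 3 := sq_sqrt (by norm_num)
  refine min_eq_right ?_
  rw [sub_le_iff_le_add, sqrt_le_left (by positivity)]
  have hQ : √(1 - (t + 1 / 2) ^ 2) ^ 2 = 1 - (t + 1 / 2) ^ 2 := sq_sqrt (by nlinarith)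
  have key : t ≤ √3 * √(1 - (t + 1 / 2) ^ 2) := by
    rw [← sqrt_mul (by norm_num)]
    apply le_sqrt_of_sq_le
    nlinarith
  nlinarith

theorem halfChord_eq_of_ge {t : ℝ} (h0 : 3 * (√5 - 1) / 8 ≤ t) (ht : t ≤ 1 / 2) :
    halfChord t = √(1 - (t + 1 / 2) ^ 2) := by
  obtain ⟨h1, h2⟩ := sqrt_five_bounds
  have h5 : √5 ^ 2 = 5 := sq_sqrt (by norm_num)
  have h3 : √3 ^ 2 = 3 := sq_sqrt (by norm_num)
  refine min_eq_left ?_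
  rw [le_sub_iff_add_le]
  apply le_sqrt_of_sq_le
  have hQ : √(1 - (t + 1 / 2) ^ 2) ^ 2 = 1 - (t + 1 / 2) ^ 2 := sq_sqrt (by nlinarith)
  have key : √3 * √(1 - (t + 1 / 2) ^ 2) ≤ t := by
    rw [← sqrt_mul (by norm_num), sqrt_le_left (by linarith)]
    nlinarith
  nlinarith

theorem integral_halfChord :
    ∫ t in (0 : ℝ)..1 / 2, halfChord t =
      (π - 6 * arcsin (1 / 4) - 3 * √3 * (√5 - 1) / 8) / 4 := by
  obtain ⟨h1, h2⟩ := sqrt_five_bounds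
  have h5 : √5 ^ 2 = 5 := sq_sqrt (by norm_num)
  have h3 : √3 ^ 2 = 3 := sq_sqrt (by norm_num)
  have hii (p q : ℝ) : IntervalIntegrable halfChord volume p q :=
    continuous_halfChord.intervalIntegrable p q
  have inner : ∫ t in (0 : ℝ)..3 * (√5 - 1) / 8, halfChord t =
      ∫ t in (0 : ℝ)..3 * (√5 - 1) / 8, (√(1 - (t + 1 / 4) ^ 2) - √3 / 4) := by
    refine intervalIntegral.integral_congr fun t ht => ?_
    rw [Set.uIcc_of_le (by linarith)] at ht
    exact halfChord_eq_of_le ht.1 ht.2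
  have outer : ∫ t in 3 * (√5 - 1) / 8..1 / 2, halfChord t =
      ∫ t in 3 * (√5 - 1) / 8..1 / 2, √(1 - (t + 1 / 2) ^ 2) := by
    refine intervalIntegral.integral_congr fun t ht => ?_
    rw [Set.uIcc_of_le (by linarith)] at ht
    exact halfChord_eq_of_ge ht.1 ht.2
  rw [← intervalIntegral.integral_add_adjacent_intervals (hii 0 (3 * (√5 - 1) / 8)) (hii _ _),
    inner, outer,
    intervalIntegral.integral_sub (Continuous.intervalIntegrable (by fun_prop) _ _)
      (Continuous.intervalIntegrable (by fun_prop) _ _),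
    intervalIntegral.integral_comp_add_right (fun u => √(1 - u ^ 2)),
    intervalIntegral.integral_comp_add_right (fun u => √(1 - u ^ 2)),
    intervalIntegral.integral_const,
    show 3 * (√5 - 1) / 8 + 1 / 4 = (3 * √5 - 1) / 8 by ring,
    show 3 * (√5 - 1) / 8 + 1 / 2 = (3 * √5 + 1) / 8 by ring,
    integral_sqrt_one_sub_sq_of_le (by norm_num) (by linarith) (by linarith),
    integral_sqrt_one_sub_sq_of_le (by linarith) (by linarith) (by norm_num),
    arcsin_three_mul_sqrt_five_sub_one_div_eight,
    arcsin_three_mul_sqrt_five_add_one_div_eight]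
  have e1 : √(1 - ((3 * √5 - 1) / 8) ^ 2) = √3 * (√5 + 1) / 8 := by
    rw [sqrt_eq_iff_mul_self_eq (by nlinarith) (by positivity)]
    linear_combination -(√5 + 1) ^ 2 / 64 * h3 - 12 / 64 * h5
  have e2 : √(1 - ((3 * √5 + 1) / 8) ^ 2) = √3 * (√5 - 1) / 8 := by
    rw [sqrt_eq_iff_mul_self_eq (by nlinarith)
      (div_nonneg (mul_nonneg (sqrt_nonneg _) (by linarith)) (by norm_num))]
    linear_combination -(√5 - 1) ^ 2 / 64 * h3 - 12 / 64 * h5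
  have e3 : √(1 - (1 / 4) ^ 2) = √3 * √5 / 4 := by
    rw [sqrt_eq_iff_mul_self_eq (by norm_num) (by positivity)]
    linear_combination -√5 ^ 2 / 16 * h3 - 3 / 16 * h5
  have e4 : (0 : ℝ) + 1 / 4 = 1 / 4 := by norm_num
  have e5 : (1 / 2 : ℝ) + 1 / 2 = 1 := by norm_num
  rw [e4, e5, e1, e2, e3, arcsin_one]
  simp only [smul_eq_mul]
  ring_nf

theorem abs_add_sq_add_le_iff {x c d e : ℝ} (hc : 0 ≤ c) :
    (|x| + c) ^ 2 + d ≤ e ↔ (x - c) ^ 2 + d ≤ e ∧ (x + c) ^ 2 + d ≤ e := by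
  rcases abs_cases x with ⟨h, h'⟩ | ⟨h, h'⟩ <;> rw [h] <;>
    refine ⟨fun h => ⟨?_, ?_⟩, fun h => ?_⟩ <;> nlinarith

theorem mem_flower_one_iff (p : EuclideanSpace ℝ (Fin 2)) :
    p ∈ flower 1 0 ↔ (|p 0| + 1 / 2) ^ 2 + p 1 ^ 2 ≤ 1 ∧
      (|p 0| + 1 / 4) ^ 2 + (|p 1| + √3 / 4) ^ 2 ≤ 1 := by
  have mem_ball (a b : ℝ) : p ∈ closedBall ((0 : EuclideanSpace ℝ (Fin 2)) +
      ((1 : ℝ) / 2) • planePt a b) 1 ↔ (p 0 - a / 2) ^ 2 + (p 1 - b / 2) ^ 2 ≤ 1 := by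
    rw [mem_closedBall, EuclideanSpace.dist_eq, sqrt_le_left (by norm_num)]
    simp [planePt, Fin.sum_univ_two, Real.dist_eq, sq_abs, div_eq_inv_mul]
  have c2 : cos (2 * π / 3) = -(1 / 2) := by
    rw [show 2 * π / 3 = π - π / 3 by ring, cos_pi_sub, cos_pi_div_three]
  have s2 : sin (2 * π / 3) = √3 / 2 := by
    rw [show 2 * π / 3 = π - π / 3 by ring, sin_pi_sub, sin_pi_div_three]
  have c4 : cos (4 * π / 3) = -(1 / 2) := by
    rw [show 4 * π / 3 = π / 3 + π by ring, cos_add_pi, cos_pi_div_three]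
  have s4 : sin (4 * π / 3) = -(√3 / 2) := by
    rw [show 4 * π / 3 = π / 3 + π by ring, sin_add_pi, sin_pi_div_three]
  have c5 : cos (5 * π / 3) = 1 / 2 := by
    rw [show 5 * π / 3 = 2 * π - π / 3 by ring, cos_two_pi_sub, cos_pi_div_three]
  have s5 : sin (5 * π / 3) = -(√3 / 2) := by
    rw [show 5 * π / 3 = 2 * π - π / 3 by ring, sin_two_pi_sub, sin_pi_div_three]
  have c3 : cos (3 * π / 3) = -1 := by rw [show 3 * π / 3 = π by ring, cos_pi]
  have s3 : sin (3 * π / 3) = 0 := by rw [show 3 * π / 3 = π by ring, sin_pi]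
  simp only [flower, Set.mem_iInter, mem_ball, Fin.forall_fin_succ, IsEmpty.forall_iff, and_true]
  norm_num [Fin.val_succ, c2, s2, c3, s3, c4, s4, c5, s5]
  rw [show √3 / 2 / 2 = √3 / 4 by ring, show -(√3 / 2) / 2 = -(√3 / 4) by ring, sub_neg_eq_add,
    abs_add_sq_add_le_iff (by norm_num), abs_add_sq_add_le_iff (by norm_num)]
  simp only [add_comm _ ((|p 1| + √3 / 4) ^ 2), abs_add_sq_add_le_iff (x := p 1)
    (show 0 ≤ √3 / 4 by positivity), add_comm ((p 1 - √3 / 4) ^ 2), add_comm ((p 1 + √3 / 4) ^ 2)]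
  tauto

theorem volume_flower_one_eq_lintegral :
    volume (flower 1 0) = ∫⁻ x : ℝ, ENNReal.ofReal (2 * halfChord |x|) := by
  set S : Set (ℝ × ℝ) := {q | (|q.1| + 1 / 2) ^ 2 + q.2 ^ 2 ≤ 1 ∧
      (|q.1| + 1 / 4) ^ 2 + (|q.2| + √3 / 4) ^ 2 ≤ 1} with hS
  have hmeas : MeasurableSet S := by
    rw [hS, Set.ofPred_and]
    refine MeasurableSet.inter ?_ ?_ <;>
      exact measurableSet_le (by fun_prop) (by fun_prop)
  have hpres := (volume_preserving_finTwoArrow ℝ).comp (PiLp.volume_preserving_ofLp (Fin 2))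
  have hpre : flower 1 0 = (MeasurableEquiv.finTwoArrow ∘ WithLp.ofLp) ⁻¹' S := by
    ext p
    rw [mem_flower_one_iff]
    rfl
  rw [hpre, hpres.measure_preimage hmeas.nullMeasurableSet, Measure.volume_eq_prod,
    Measure.prod_apply hmeas]
  refine lintegral_congr fun x => ?_
  rcases le_or_gt |x| (1 / 2) with hx | hx
  · have hx0 := abs_nonneg x
    have hslice : Prod.mk x ⁻¹' S = closedBall 0 (halfChord |x|) := by
      ext y
      simp only [hS, Set.mem_preimage, Set.mem_ofPred_eq, mem_closedBall, Real.dist_eq, sub_zero,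
        halfChord, le_min_iff, le_sub_iff_add_le]
      rw [le_sqrt (abs_nonneg y) (by nlinarith), le_sqrt (by positivity) (by nlinarith), sq_abs,
        le_sub_iff_add_le', le_sub_iff_add_le']
    rw [hslice, Real.volume_closedBall]
  · have hslice : Prod.mk x ⁻¹' S = ∅ := by
      ext y
      simp only [hS, Set.mem_preimage, Set.mem_ofPred_eq, Set.mem_empty_iff_false, iff_false]
      rintro ⟨h, -⟩
      nlinarith [sq_nonneg y]
    rw [hslice, measure_empty, ENNReal.ofReal_of_nonpos]
    linarith [halfChord_nonpos hx]

theorem volume_flower_one : (volume (flower 1 0)).toReal =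
    π - 6 * arcsin (1 / 4) - 3 * √3 * (√5 - 1) / 8 := by
  have hcont := continuous_halfChord
  have hmax (x : ℝ) : ENNReal.ofReal (2 * halfChord |x|) =
      ENNReal.ofReal (max 0 (2 * halfChord |x|)) := by simp
  simp_rw [volume_flower_one_eq_lintegral, hmax]
  rw [← integral_eq_lintegral_of_nonneg_ae (f := fun x => max 0 (2 * halfChord |x|))
      (.of_forall fun x => le_max_left _ _)
      (Continuous.aestronglyMeasurable (by fun_prop)),
    integral_comp_abs (f := fun t => max 0 (2 * halfChord t)),
    setIntegral_eq_of_subset_of_forall_sdiff_eq_zero measurableSet_Ioi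
      (Set.Ioc_subset_Ioi_self : Set.Ioc (0 : ℝ) (1 / 2) ⊆ Set.Ioi 0)
      fun t ht => ?_,
    ← intervalIntegral.integral_of_le (by norm_num),
    intervalIntegral.integral_congr (g := fun t => 2 * halfChord t) fun t ht => ?_,
    intervalIntegral.integral_const_mul, integral_halfChord]
  · ring
  · rw [Set.uIcc_of_le (by norm_num)] at ht
    exact max_eq_right (by linarith [halfChord_nonneg ht.1 ht.2])
  · have h : 1 / 2 < t := not_le.1 fun h => ht.2 ⟨ht.1, h⟩
    exact max_eq_left (by linarith [halfChord_nonpos h])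

open scoped Pointwise in
theorem flower_eq_smul {s : ℝ} (hs : 0 < s) : flower s 0 = s • flower 1 0 := by
  have hs' : s ≠ 0 := hs.ne'
  have hball (k : Fin 6) : closedBall ((0 : EuclideanSpace ℝ (Fin 2)) +
      (s / 2) • planePt (cos ((k : ℕ) * π / 3)) (sin ((k : ℕ) * π / 3))) s =
      s • closedBall ((0 : EuclideanSpace ℝ (Fin 2)) +
        ((1 : ℝ) / 2) • planePt (cos ((k : ℕ) * π / 3)) (sin ((k : ℕ) * π / 3))) 1 := by
    rw [smul_closedBall' hs', zero_add, zero_add, smul_smul, norm_of_nonneg hs.le, mul_one,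
      mul_one_div]
  ext p
  simp only [flower, hball, Set.mem_iInter, Set.mem_smul_set_iff_inv_smul_mem₀ hs']

theorem volume_flower {s : ℝ} (hs : 0 < s) : (volume (flower s 0)).toReal =
    (π - 6 * arcsin (1 / 4) - 3 * √3 * (√5 - 1) / 8) * s ^ 2 := by
  rw [flower_eq_smul hs, Measure.addHaar_smul, finrank_euclideanSpace_fin, ENNReal.toReal_mul,
    volume_flower_one, ENNReal.toReal_ofReal (abs_nonneg _), abs_of_pos (by positivity), mul_comm]

/-- The area of the flower region around the origin of the triangular
lattice with edge length `s` is `(π − 6 arcsin(1/4) − 3√3(√5 − 1)/8)·s²`; equivalently,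
for edge length `r/2` the flower area is `S_f = (1/4)(π − 6φ − 3√3(√5−1)/8)·r²`
with `φ = arcsin(1/4)`. -/
theorem flower_area (s : ℝ) (hs : 0 < s) :
    (volume (flower s 0)).toReal =
        (Real.pi - 6 * Real.arcsin (1 / 4) - 3 * Real.sqrt 3 * (Real.sqrt 5 - 1) / 8) * s ^ 2 ∧
      ∀ r : ℝ, r = 2 * s →
        (volume (flower (r / 2) 0)).toReal =
          (1 / 4) * (Real.pi - 6 * Real.arcsin (1 / 4)
            - 3 * Real.sqrt 3 * (Real.sqrt 5 - 1) / 8) * r ^ 2 := by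
  refine ⟨volume_flower hs, ?_⟩
  rintro r rfl
  rw [volume_flower (by linarith)]
  ring
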